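/- arXiv:1910.05467 — 3 statements merged into one kernel-verified Lean document; each statement's English description precedes it below -/
import Mathlib

section
/- Let d, n be positive integers, λ a real number, θ ∈ ℝ^d a vector, α₁, …, αₙ real d×d matrices, and β₁, …, βₙ ∈ ℝ^d vectors. Define the sequence of local models by θ₁ = θ and, for i = 1, …, n, ∇ᵢ = (1/4)·αᵢ·θᵢ − (1/2)·βᵢ and θ_{i+1} = θᵢ − λ·∇ᵢ. Then the total update Δ = θ₁ − θ_{n+1} satisfies Δ = [I − ∏_{i=1}^{n} (I − (λ/4)·αᵢ)]·θ − (λ/2)·( Σ_{i=1}^{n−1} [∏_{j=i+1}^{n} (I − (λ/4)·αⱼ)]·βᵢ + βₙ ), where ∏_{i=1}^{k} Mᵢ denotes the ordered product M_k·M_{k−1}⋯M₁ and I is the d×d identity matrix. -/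
open Matrix

/-- Ordered product `M b * M (b-1) * ⋯ * M a` (the identity matrix if `b < a`). -/
noncomputable def ordProd {d : ℕ} (M : ℕ → Matrix (Fin d) (Fin d) ℝ) (a b : ℕ) :
    Matrix (Fin d) (Fin d) ℝ :=
  ((List.range' a (b + 1 - a)).reverse.map M).prod

theorem ordProd_self_succ {d : ℕ} (M : ℕ → Matrix (Fin d) (Fin d) ℝ) (n : ℕ) :
    ordProd M (n + 1) n = 1 := by
  simp [ordProd]

theorem ordProd_succ {d : ℕ} (M : ℕ → Matrix (Fin d) (Fin d) ℝ) {a b : ℕ} (h : a ≤ b + 1) :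
    ordProd M a (b + 1) = M (b + 1) * ordProd M a b := by
  have hlen : b + 1 + 1 - a = (b + 1 - a) + 1 := by omega
  have hlast : a + (b + 1 - a) = b + 1 := by omega
  simp [ordProd, hlen, List.range'_concat, hlast]

/-- Variation of constants for an affine recurrence `x (i + 1) = M i *ᵥ x i + b i`. -/
theorem affine_recurrence_eq {d : ℕ} (M : ℕ → Matrix (Fin d) (Fin d) ℝ)
    (x b : ℕ → Fin d → ℝ) (n : ℕ)
    (h : ∀ i, 1 ≤ i → i ≤ n → x (i + 1) = M i *ᵥ x i + b i) :
    x (n + 1) = ordProd M 1 n *ᵥ x 1 + ∑ i ∈ Finset.Ico 1 (n + 1), ordProd M (i + 1) n *ᵥ b i := by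
  induction n with
  | zero => simp [ordProd_self_succ M 0]
  | succ n ih =>
    have hsum : ∑ i ∈ Finset.Ico 1 (n + 1), ordProd M (i + 1) (n + 1) *ᵥ b i =
        M (n + 1) *ᵥ ∑ i ∈ Finset.Ico 1 (n + 1), ordProd M (i + 1) n *ᵥ b i := by
      rw [Matrix.mulVec_sum]
      refine Finset.sum_congr rfl fun i hi => ?_
      have hi' := (Finset.mem_Ico.mp hi).2
      rw [ordProd_succ M (by omega), Matrix.mulVec_mulVec]
    rw [h (n + 1) (by omega) le_rfl, ih fun i h₁ h₂ => h i h₁ (by omega),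
      Finset.sum_Ico_succ_top (by omega : 1 ≤ n + 1), hsum, ordProd_self_succ,
      ordProd_succ M (by omega), Matrix.mulVec_add, Matrix.mulVec_mulVec, Matrix.one_mulVec,
      add_assoc]

/-- Closed form of the total update `Δ = θ₁ − θ_{n+1}` of asynchronized
local SGD with per-batch gradients `∇ᵢ = (1/4)·αᵢ·θᵢ − (1/2)·βᵢ`. -/
theorem total_update_closed_form
    (d n : ℕ) (hd : 0 < d) (hn : 0 < n) (lam : ℝ)
    (θ : Fin d → ℝ)
    (α : ℕ → Matrix (Fin d) (Fin d) ℝ) (β : ℕ → Fin d → ℝ)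
    (θs grad : ℕ → Fin d → ℝ)
    (hθ1 : θs 1 = θ)
    (hgrad : ∀ i, 1 ≤ i → i ≤ n →
      grad i = (1 / 4 : ℝ) • (α i).mulVec (θs i) - (1 / 2 : ℝ) • β i)
    (hθ : ∀ i, 1 ≤ i → i ≤ n → θs (i + 1) = θs i - lam • grad i) :
    θs 1 - θs (n + 1) =
      (1 - ordProd (fun i => 1 - (lam / 4) • α i) 1 n).mulVec θ -
        (lam / 2) •
          ((∑ i ∈ Finset.Ico 1 n,
              (ordProd (fun j => 1 - (lam / 4) • α j) (i + 1) n).mulVec (β i)) + β n) := by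
  have hstep : ∀ i, 1 ≤ i → i ≤ n →
      θs (i + 1) = (1 - (lam / 4) • α i) *ᵥ θs i + (lam / 2) • β i := by
    intro i h₁ h₂
    rw [hθ i h₁ h₂, hgrad i h₁ h₂, Matrix.sub_mulVec, Matrix.one_mulVec, Matrix.smul_mulVec]
    module
  rw [affine_recurrence_eq (fun i => 1 - (lam / 4) • α i) θs (fun i => (lam / 2) • β i) n hstep,
    Finset.sum_Ico_succ_top hn, ordProd_self_succ, Matrix.one_mulVec, Matrix.sub_mulVec,
    Matrix.one_mulVec, hθ1]
  simp only [Matrix.mulVec_smul, ← Finset.smul_sum]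
  module
end

section
/- Let d ≥ 1 and n ≥ 2 be integers, λ ≠ 0 a real number, and γ a real d×d matrix. If there exists at least one n-tuple (α₁, …, αₙ) of symmetric real d×d matrices satisfying γ = I − ∏_{i=1}^{n} (I − (λ/4)·αᵢ) (where ∏_{i=1}^{n} Mᵢ denotes the ordered product Mₙ·M_{n−1}⋯M₁), then the set of n-tuples of symmetric real d×d matrices satisfying this equation is infinite. -/
open Matrix

/-- Ordered product `M (n-1) * M (n-2) * ⋯ * M 0` of a tuple of `n` matrices
(this is `∏_{i=1}^{n} Mᵢ = Mₙ·M_{n−1}⋯M₁` for the 1-based tuple `(M₁,…,Mₙ)`). -/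
noncomputable def ordProdTuple {d n : ℕ} (M : Fin n → Matrix (Fin d) (Fin d) ℝ) :
    Matrix (Fin d) (Fin d) ℝ :=
  ((List.finRange n).reverse.map M).prod

theorem ordProdTuple_smul {d n : ℕ} (c : Fin n → ℝ) (M : Fin n → Matrix (Fin d) (Fin d) ℝ) :
    ordProdTuple (fun i => c i • M i) = (∏ i, c i) • ordProdTuple M := by
  have key : ∀ l : List (Fin n),
      (l.map fun i => c i • M i).prod = (l.map c).prod • (l.map M).prod := by
    intro l
    induction l with
    | nil => simp
    | cons a l ih => simp [ih, smul_smul, mul_comm]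
  rw [ordProdTuple, ordProdTuple, key, List.map_reverse, List.prod_reverse, Fin.prod_univ_def]

theorem ordProdTuple_eq_zero {d n : ℕ} {M : Fin n → Matrix (Fin d) (Fin d) ℝ} {i : Fin n}
    (h : M i = 0) : ordProdTuple M = 0 := by
  apply List.prod_eq_zero
  simp only [List.mem_map, List.mem_reverse, List.mem_finRange, true_and]
  exact ⟨i, h⟩

/-- A product of at least two symmetric matrices has infinitely many factorizations into symmetric
matrices: rescale two factors by inverse scalars, or, if one factor vanishes, change the other. -/
theorem infinite_symm_ordProdTuple_eq {d n : ℕ} (hd : 1 ≤ d) (hn : 2 ≤ n)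
    (M : Fin n → Matrix (Fin d) (Fin d) ℝ) (hM : ∀ i, (M i).IsSymm) :
    {N : Fin n → Matrix (Fin d) (Fin d) ℝ |
      (∀ i, (N i).IsSymm) ∧ ordProdTuple N = ordProdTuple M}.Infinite := by
  have : Nonempty (Fin d) := ⟨⟨0, hd⟩⟩
  obtain ⟨a, b, hab⟩ : ∃ a b : Fin n, a ≠ b :=
    ⟨⟨0, by omega⟩, ⟨1, by omega⟩, by simp⟩
  by_cases ha : M a = 0
  · refine Set.infinite_of_injective_forall_mem
      (f := fun k : ℕ => Function.update M b ((k : ℝ) • 1)) ?_ ?_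
    · intro k l h
      have h' := smul_left_injective ℝ one_ne_zero (Function.update_injective M b h)
      exact_mod_cast h'
    · intro k
      refine ⟨fun i => ?_, ?_⟩
      · rcases eq_or_ne i b with rfl | hi
        · simp
        · simpa [hi] using hM i
      · rw [ordProdTuple_eq_zero ha, ordProdTuple_eq_zero (i := a)]
        simpa [hab] using ha
  · let c : ℕ → Fin n → ℝ := fun k =>
      Pi.mulSingle a ((k : ℝ) + 1) * Pi.mulSingle b ((k : ℝ) + 1)⁻¹
    refine Set.infinite_of_injective_forall_mem (f := fun k : ℕ => fun i => c k i • M i) ?_ ?_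
    · intro k l h
      have h' := smul_left_injective ℝ ha (congrFun h a)
      simpa [c, hab] using h'
    · intro k
      refine ⟨fun i => (hM i).smul _, ?_⟩
      have hc : ∏ i, c k i = 1 := by
        have hk : (k : ℝ) + 1 ≠ 0 := by positivity
        simp [c, Finset.prod_mul_distrib, hk]
      rw [ordProdTuple_smul, hc, one_smul]

/-- If `γ = I − ∏_{i=1}^{n} (I − (λ/4)·αᵢ)` has at least one solution in
symmetric matrices `(α₁,…,αₙ)` with `n ≥ 2`, then it has infinitely many such solutions. -/
theorem infinitely_many_symmetric_solutions
    (d n : ℕ) (hd : 1 ≤ d) (hn : 2 ≤ n) (lam : ℝ) (hlam : lam ≠ 0)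
    (γ : Matrix (Fin d) (Fin d) ℝ)
    (hex : ∃ α : Fin n → Matrix (Fin d) (Fin d) ℝ,
      (∀ i, (α i).IsSymm) ∧
        γ = 1 - ordProdTuple (fun i => 1 - (lam / 4) • α i)) :
    {α : Fin n → Matrix (Fin d) (Fin d) ℝ |
      (∀ i, (α i).IsSymm) ∧
        γ = 1 - ordProdTuple (fun i => 1 - (lam / 4) • α i)}.Infinite := by
  obtain ⟨α, hα, rfl⟩ := hex
  have hl : lam / 4 ≠ 0 := div_ne_zero hlam (by norm_num)
  have hinf := infinite_symm_ordProdTuple_eq hd hn (fun i => 1 - (lam / 4) • α i)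
    fun i => Matrix.isSymm_one.sub ((hα i).smul _)
  have hinj : Function.Injective fun (N : Fin n → Matrix (Fin d) (Fin d) ℝ) i =>
      (lam / 4)⁻¹ • (1 - N i) := by
    intro N N' h
    funext i
    exact sub_right_injective (smul_right_injective _ (inv_ne_zero hl) (congrFun h i))
  refine (hinf.image hinj.injOn).mono ?_
  rintro _ ⟨N, ⟨hN, hprod⟩, rfl⟩
  refine ⟨fun i => (Matrix.isSymm_one.sub (hN i)).smul _, ?_⟩
  simp only [smul_inv_smul₀ hl, sub_sub_cancel]
  rw [hprod]
end

section
/- Let d be a positive integer, λ ≠ 0 a real number, α and α′ real d×d matrices, and β, β′ ∈ ℝ^d. Suppose S ⊆ ℝ^d is a set of vectors whose affine span is all of ℝ^d, and suppose that for every θ ∈ S we have λ·((1/4)·α·θ − (1/2)·β) = λ·((1/4)·α′·θ − (1/2)·β′). Then α = α′ and β = β′. -/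
open Matrix

/-- If the observed models `θ ∈ S` affinely span `ℝ^d` and the gradients
`λ·((1/4)·α·θ − (1/2)·β)` agree with `λ·((1/4)·α′·θ − (1/2)·β′)` on all of `S` (with `λ ≠ 0`),
then `α = α′` and `β = β′`. -/
theorem gradient_determines_alpha_beta
    (d : ℕ) (hd : 0 < d) (lam : ℝ) (hlam : lam ≠ 0)
    (α α' : Matrix (Fin d) (Fin d) ℝ) (β β' : Fin d → ℝ)
    (S : Set (Fin d → ℝ)) (hS : affineSpan ℝ S = ⊤)
    (h : ∀ θ ∈ S,
      lam • ((1 / 4 : ℝ) • α.mulVec θ - (1 / 2 : ℝ) • β) =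
        lam • ((1 / 4 : ℝ) • α'.mulVec θ - (1 / 2 : ℝ) • β')) :
    α = α' ∧ β = β' := by
  let gradient (A : Matrix (Fin d) (Fin d) ℝ) (b : Fin d → ℝ) : (Fin d → ℝ) →ᵃ[ℝ] (Fin d → ℝ) :=
    ((1 / 4 : ℝ) • A.mulVecLin).toAffineMap - AffineMap.const ℝ _ ((1 / 2 : ℝ) • b)
  have hgrad : gradient α β = gradient α' β' :=
    AffineMap.ext_on hS fun θ hθ => smul_right_injective _ hlam (h θ hθ)
  have hval (θ : Fin d → ℝ) : (1 / 4 : ℝ) • α.mulVec θ - (1 / 2 : ℝ) • β =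
      (1 / 4 : ℝ) • α'.mulVec θ - (1 / 2 : ℝ) • β' := DFunLike.congr_fun hgrad θ
  have hβ : β = β' := by simpa using hval 0
  subst hβ
  refine ⟨Matrix.ext_of_mulVec_single fun i => ?_, rfl⟩
  simpa using hval (Pi.single i 1)
end
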